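/- arXiv:2312.12890 — 2 statements merged into one kernel-verified Lean document; each statement's English description precedes it below -/
import Mathlib

section
/- Suppose F ∈ ℝ[x,y] is an irreducible polynomial of degree d ≥ 2, I ⊂ ℝ is an interval, and f ∈ C^∞(I) satisfies F(x, f(x)) = 0 for all x ∈ I and f is not a polynomial. Then for any k ≥ 1 and any nonzero c ∈ ℝ, the number of x ∈ I with f^{(k)}(x) = c is O(k·d²), with absolute implied constant. -/
open Set MvPolynomial

/-- If the entries in column `j` of a polynomial matrix have degree at most `w j`, its determinant
has degree at most `∑ j, w j`. -/
lemma natDegree_det_le_sum_of_column_le {n : ℕ} (M : Matrix (Fin n) (Fin n) (Polynomial ℝ))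
    (w : Fin n → ℕ) (h : ∀ i j, (M i j).natDegree ≤ w j) : M.det.natDegree ≤ ∑ j, w j := by
  rw [Matrix.det_apply]
  refine Polynomial.natDegree_sum_le_of_forall_le _ _ fun σ _ => ?_
  refine (Polynomial.natDegree_smul_le _ _).trans ?_
  exact (Polynomial.natDegree_prod_le _ _).trans (Finset.sum_le_sum fun j _ => h _ _)

lemma natDegree_resultant_le (f g : Polynomial (Polynomial ℝ)) (m n D E : ℕ)
    (hf : ∀ i, (f.coeff i).natDegree ≤ D) (hg : ∀ i, (g.coeff i).natDegree ≤ E) :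
    (Polynomial.resultant f g m n).natDegree ≤ m * E + n * D := by
  refine (natDegree_det_le_sum_of_column_le _
    (fun j => j.addCases (fun _ => E) (fun _ => D)) fun i j => ?_).trans ?_
  · induction j using Fin.addCases with
    | left j =>
      simp only [Polynomial.sylvester, Matrix.of_apply, Fin.addCases_left]
      split_ifs
      · exact hg _
      · simp
    | right j =>
      simp only [Polynomial.sylvester, Matrix.of_apply, Fin.addCases_right]
      split_ifs
      · exact hf _
      · simp
  · simp [Fin.sum_univ_add]

lemma resultant_ne_zero_of_irreducible {f g : Polynomial (Polynomial ℝ)} (hf : Irreducible f)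
    (h0 : f.natDegree ≠ 0) (hfg : ¬ f ∣ g) : Polynomial.resultant f g ≠ 0 := by
  have hprim : f.IsPrimitive := hf.isPrimitive h0
  have hinj : Function.Injective (algebraMap (Polynomial ℝ) (RatFunc ℝ)) :=
    IsFractionRing.injective _ _
  have hcop : IsCoprime (f.map (algebraMap (Polynomial ℝ) (RatFunc ℝ)))
      (g.map (algebraMap (Polynomial ℝ) (RatFunc ℝ))) := by
    refine (((hprim.irreducible_iff_irreducible_map_fraction_map
      (K := RatFunc ℝ)).1 hf).coprime_iff_not_dvd).2 fun h => hfg ?_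
    exact hprim.dvd_of_fraction_map_dvd_fraction_map h
  have := Polynomial.resultant_ne_zero _ _ hcop
  rw [Polynomial.natDegree_map_eq_of_injective hinj, Polynomial.natDegree_map_eq_of_injective hinj,
    Polynomial.resultant_map_map] at this
  exact fun h => this (by rw [h, map_zero])

open Polynomial.Bivariate in
lemma equivMvPolynomial_symm_eq_sum (P : MvPolynomial (Fin 2) ℝ) :
    (equivMvPolynomial ℝ).symm P = ∑ s ∈ P.support,
      Polynomial.C (Polynomial.C (P.coeff s) * Polynomial.X ^ s 0) * Polynomial.X ^ s 1 := by
  conv_lhs => rw [P.as_sum, map_sum]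
  refine Finset.sum_congr rfl fun s _ => ?_
  rw [monomial_eq, Finsupp.prod_fintype _ _ (by simp)]
  simp [Fin.prod_univ_two, mul_assoc]

lemma apply_zero_add_apply_one_le_totalDegree {P : MvPolynomial (Fin 2) ℝ} {s : Fin 2 →₀ ℕ}
    (hs : s ∈ P.support) : s 0 + s 1 ≤ P.totalDegree := by
  have := le_totalDegree hs
  rwa [Finsupp.sum_fintype _ _ (by simp), Fin.sum_univ_two] at this

open Polynomial.Bivariate in
lemma natDegree_equivMvPolynomial_symm_le (P : MvPolynomial (Fin 2) ℝ) :
    ((equivMvPolynomial ℝ).symm P).natDegree ≤ P.totalDegree := by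
  rw [equivMvPolynomial_symm_eq_sum]
  refine Polynomial.natDegree_sum_le_of_forall_le _ _ fun s hs => ?_
  refine (Polynomial.natDegree_C_mul_X_pow_le _ _).trans ?_
  have := apply_zero_add_apply_one_le_totalDegree hs
  lia

open Polynomial.Bivariate in
lemma natDegree_coeff_equivMvPolynomial_symm_le (P : MvPolynomial (Fin 2) ℝ) (i : ℕ) :
    (((equivMvPolynomial ℝ).symm P).coeff i).natDegree ≤ P.totalDegree := by
  rw [equivMvPolynomial_symm_eq_sum, Polynomial.finsetSum_coeff]
  refine Polynomial.natDegree_sum_le_of_forall_le _ _ fun s hs => ?_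
  rw [Polynomial.coeff_C_mul_X_pow]
  split_ifs
  · refine (Polynomial.natDegree_C_mul_X_pow_le _ _).trans ?_
    have := apply_zero_add_apply_one_le_totalDegree hs
    lia
  · simp

open Polynomial.Bivariate in
lemma evalEval_equivMvPolynomial_symm (P : MvPolynomial (Fin 2) ℝ) (x y : ℝ) :
    ((equivMvPolynomial ℝ).symm P).evalEval x y = eval ![x, y] P := by
  induction P using MvPolynomial.induction_on with
  | C a => simp
  | add p q hp hq => simp [hp, hq, Polynomial.evalEval_add]
  | mul_X p i hp =>
    rw [map_mul, map_mul, Polynomial.evalEval_mul, hp]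
    fin_cases i
    · simp [Polynomial.evalEval_C]
    · simp

open Polynomial.Bivariate in
/-- A weak form of Bézout's theorem, counting abscissae of common zeros. -/
lemma ncard_abscissae_common_zeros_le {F G : MvPolynomial (Fin 2) ℝ} (hF : Irreducible F)
    (h0 : ((equivMvPolynomial ℝ).symm F).natDegree ≠ 0) (hFG : ¬ F ∣ G) :
    {x : ℝ | ∃ y, eval ![x, y] F = 0 ∧ eval ![x, y] G = 0}.Finite ∧
    {x : ℝ | ∃ y, eval ![x, y] F = 0 ∧ eval ![x, y] G = 0}.ncard ≤
      2 * F.totalDegree * G.totalDegree := by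
  set f := (equivMvPolynomial ℝ).symm F with hf
  set g := (equivMvPolynomial ℝ).symm G with hg
  have hr : Polynomial.resultant f g ≠ 0 := by
    refine resultant_ne_zero_of_irreducible ?_ h0 ?_
    · exact (MulEquiv.irreducible_iff (equivMvPolynomial ℝ).symm).2 hF
    · rwa [hf, hg, map_dvd_iff]
  have hdeg : (Polynomial.resultant f g).natDegree ≤ 2 * F.totalDegree * G.totalDegree := by
    refine (natDegree_resultant_le f g _ _ _ _ (natDegree_coeff_equivMvPolynomial_symm_le F)
      (natDegree_coeff_equivMvPolynomial_symm_le G)).trans ?_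
    have h1 := Nat.mul_le_mul_right G.totalDegree (natDegree_equivMvPolynomial_symm_le F)
    have h2 := Nat.mul_le_mul_right F.totalDegree (natDegree_equivMvPolynomial_symm_le G)
    rw [← hf] at h1
    rw [← hg] at h2
    nlinarith
  have hsub : {x : ℝ | ∃ y, eval ![x, y] F = 0 ∧ eval ![x, y] G = 0} ⊆
      ((Polynomial.resultant f g).roots.toFinset : Set ℝ) := by
    rintro x ⟨y, hFx, hGx⟩
    obtain ⟨p, q, -, -, hpq⟩ := Polynomial.exists_mul_add_mul_eq_C_resultant f g le_rfl le_rfl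
      (Or.inl h0)
    have := congrArg (Polynomial.evalEval x y) hpq
    rw [Polynomial.evalEval_add, Polynomial.evalEval_mul, Polynomial.evalEval_mul, hf, hg,
      evalEval_equivMvPolynomial_symm, evalEval_equivMvPolynomial_symm, hFx, hGx,
      Polynomial.evalEval_C] at this
    simp only [Finset.mem_coe, Multiset.mem_toFinset]
    rw [Polynomial.mem_roots hr, Polynomial.IsRoot, ← this]
    ring
  refine ⟨(Finset.finite_toSet _).subset hsub, ?_⟩
  refine (Set.ncard_le_ncard hsub (Finset.finite_toSet _)).trans ?_
  rw [Set.ncard_coe_finset]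
  exact (Multiset.toFinset_card_le _).trans ((Polynomial.card_roots' _).trans hdeg)

lemma totalDegree_pderiv_le {σ : Type*} (i : σ) (P : MvPolynomial σ ℝ) :
    (pderiv i P).totalDegree ≤ P.totalDegree := by
  conv_lhs => rw [P.as_sum, map_sum]
  refine totalDegree_finsetSum_le fun s hs => ?_
  rw [pderiv_monomial]
  refine (totalDegree_monomial_le _ _).trans (le_trans ?_ (le_totalDegree hs))
  exact Finsupp.degree_mono (tsub_le_self)

/-- The polynomials `H` with `H(x, f) + F_y(x, f) ^ (2 j + 1) f ^ (j + 1) = 0` on a curve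
`F(x, f) = 0`. -/
noncomputable def derivNumerator (F : MvPolynomial (Fin 2) ℝ) : ℕ → MvPolynomial (Fin 2) ℝ
  | 0 => pderiv 0 F
  | j + 1 =>
    pderiv 1 F ^ 2 * pderiv 0 (derivNumerator F j)
      - pderiv 0 F * pderiv 1 F * pderiv 1 (derivNumerator F j)
      - C (2 * (j : ℝ) + 1) * (pderiv 0 (pderiv 1 F) * pderiv 1 F - pderiv 1 (pderiv 1 F) * pderiv 0 F)
        * derivNumerator F j

lemma totalDegree_mul_le_of_le {P Q : MvPolynomial (Fin 2) ℝ} {m n : ℕ}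
    (hP : P.totalDegree ≤ m) (hQ : Q.totalDegree ≤ n) : (P * Q).totalDegree ≤ m + n :=
  (totalDegree_mul P Q).trans (add_le_add hP hQ)

lemma totalDegree_sub_le_of_le {P Q : MvPolynomial (Fin 2) ℝ} {m : ℕ}
    (hP : P.totalDegree ≤ m) (hQ : Q.totalDegree ≤ m) : (P - Q).totalDegree ≤ m :=
  (totalDegree_sub P Q).trans (max_le hP hQ)

lemma totalDegree_derivNumerator_le (F : MvPolynomial (Fin 2) ℝ) (j : ℕ) :
    (derivNumerator F j).totalDegree ≤ (2 * j + 1) * F.totalDegree := by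
  induction j with
  | zero => simpa [derivNumerator] using totalDegree_pderiv_le 0 F
  | succ j ih =>
    have h0 := totalDegree_pderiv_le 0 F
    have h1 := totalDegree_pderiv_le 1 F
    have h01 := (totalDegree_pderiv_le 0 _).trans h1
    have h11 := (totalDegree_pderiv_le 1 _).trans h1
    have hH0 := (totalDegree_pderiv_le 0 _).trans ih
    have hH1 := (totalDegree_pderiv_le 1 _).trans ih
    have e : (2 * (j + 1) + 1) * F.totalDegree =
        (F.totalDegree + F.totalDegree) + (2 * j + 1) * F.totalDegree := by ring
    rw [derivNumerator, e, pow_two]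
    refine totalDegree_sub_le_of_le (totalDegree_sub_le_of_le ?_ ?_) ?_
    · exact totalDegree_mul_le_of_le (totalDegree_mul_le_of_le h1 h1) hH0
    · exact totalDegree_mul_le_of_le (totalDegree_mul_le_of_le h0 h1) hH1
    · refine totalDegree_mul_le_of_le ?_ ih
      refine (totalDegree_mul_le_of_le (m := 0) (totalDegree_C _).le (totalDegree_sub_le_of_le
        (totalDegree_mul_le_of_le h01 h1) (totalDegree_mul_le_of_le h11 h0))).trans (by simp)

lemma hasDerivWithinAt_eval_graph {f : ℝ → ℝ} {s : Set ℝ} {x f' : ℝ}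
    (hf : HasDerivWithinAt f f' s x) (P : MvPolynomial (Fin 2) ℝ) :
    HasDerivWithinAt (fun t => eval ![t, f t] P)
      (eval ![x, f x] (pderiv 0 P) + eval ![x, f x] (pderiv 1 P) * f') s x := by
  induction P using MvPolynomial.induction_on with
  | C a => simpa using hasDerivWithinAt_const x s a
  | add p q hp hq =>
    simp only [map_add]
    exact (hp.add hq).congr_deriv (by ring)
  | mul_X p i hp =>
    simp only [map_mul, Derivation.leibniz, smul_eq_mul, map_add, eval_X]
    fin_cases i
    · refine (hp.mul (hasDerivWithinAt_id x s)).congr_deriv ?_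
      simp [pderiv_X]
      ring
    · refine (hp.mul hf).congr_deriv ?_
      simp [pderiv_X]
      ring

lemma eval_derivNumerator_add {a b : ℝ} (hab : a < b) {F : MvPolynomial (Fin 2) ℝ} {f : ℝ → ℝ}
    (hf : ContDiffOn ℝ (⊤ : ℕ∞) f (Icc a b))
    (hF : ∀ x ∈ Icc a b, eval ![x, f x] F = 0) (j : ℕ) :
    ∀ x ∈ Icc a b, eval ![x, f x] (derivNumerator F j) +
      eval ![x, f x] (pderiv 1 F) ^ (2 * j + 1) * iteratedDerivWithin (j + 1) f (Icc a b) x = 0 := by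
  have hu := uniqueDiffOn_Icc hab
  have hD : ∀ (k : ℕ), ∀ x ∈ Icc a b, HasDerivWithinAt (iteratedDerivWithin k f (Icc a b))
      (iteratedDerivWithin (k + 1) f (Icc a b) x) (Icc a b) x := by
    intro k x hx
    rw [iteratedDerivWithin_succ]
    exact (hf.differentiableOn_iteratedDerivWithin (by exact_mod_cast WithTop.coe_lt_top _)
      hu x hx).hasDerivWithinAt
  have hzero : ∀ {g : ℝ → ℝ} {g' x : ℝ}, (∀ t ∈ Icc a b, g t = 0) → x ∈ Icc a b →
      HasDerivWithinAt g g' (Icc a b) x → g' = 0 := by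
    intro g g' x hg hx h
    exact (hu x hx).eq_deriv _ h
      ((hasDerivWithinAt_const x _ (0 : ℝ)).congr_of_mem hg hx)
  have hf1 : ∀ x ∈ Icc a b, HasDerivWithinAt f
      (iteratedDerivWithin 1 f (Icc a b) x) (Icc a b) x := by
    intro x hx
    simpa using hD 0 x hx
  have hH0 : ∀ x ∈ Icc a b, eval ![x, f x] (pderiv 0 F) +
      eval ![x, f x] (pderiv 1 F) * iteratedDerivWithin 1 f (Icc a b) x = 0 :=
    fun x hx => hzero hF hx (hasDerivWithinAt_eval_graph (hf1 x hx) F)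
  induction j with
  | zero =>
    intro x hx
    simpa [derivNumerator] using hH0 x hx
  | succ j ih =>
    intro x hx
    have h1 := hzero ih hx ((hasDerivWithinAt_eval_graph (hf1 x hx) (derivNumerator F j)).add
      (((hasDerivWithinAt_eval_graph (hf1 x hx) (pderiv 1 F)).pow (2 * j + 1)).mul
        (hD (j + 1) x hx)))
    have h2 := ih x hx
    have h3 := hH0 x hx
    simp only [derivNumerator, map_sub, map_mul, map_pow, eval_C]
    simp only [Nat.add_sub_cancel, Nat.cast_add, Nat.cast_mul, Nat.cast_ofNat, Nat.cast_one,
      Pi.pow_apply] at h1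
    generalize iteratedDerivWithin (j + 1 + 1) f (Icc a b) x = w at *
    generalize iteratedDerivWithin (j + 1) f (Icc a b) x = v at *
    generalize iteratedDerivWithin 1 f (Icc a b) x = u at *
    generalize eval ![x, f x] (pderiv 0 (derivNumerator F j)) = Hx at *
    generalize eval ![x, f x] (pderiv 1 (derivNumerator F j)) = Hy at *
    generalize eval ![x, f x] (derivNumerator F j) = H at *
    generalize eval ![x, f x] (pderiv 0 (pderiv 1 F)) = Fxy at *
    generalize eval ![x, f x] (pderiv 1 (pderiv 1 F)) = Fyy at *
    generalize eval ![x, f x] (pderiv 1 F) = Fy at *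
    generalize eval ![x, f x] (pderiv 0 F) = Fx at *
    have e : Fy ^ (2 * (j + 1) + 1) = Fy ^ (2 * j) * Fy ^ 3 := by ring
    have e' : Fy ^ (2 * j + 1) = Fy ^ (2 * j) * Fy := by ring
    rw [e]
    rw [e'] at h1 h2
    generalize Fy ^ (2 * j) = G at *
    linear_combination Fy ^ 2 * h1 - (Fy * Hy + (2 * j + 1) * G * v * Fy * Fyy) * h3
      - (2 * j + 1) * (Fxy * Fy - Fyy * Fx) * h2

lemma exists_derivative_eq (Q : Polynomial ℝ) : ∃ P, Polynomial.derivative P = Q := by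
  induction Q using Polynomial.induction_on' with
  | add p q hp hq =>
    obtain ⟨P, rfl⟩ := hp
    obtain ⟨P', rfl⟩ := hq
    exact ⟨P + P', Polynomial.derivative_add⟩
  | monomial n a =>
    refine ⟨Polynomial.monomial (n + 1) (a / (n + 1)), ?_⟩
    rw [Polynomial.derivative_monomial_succ, div_mul_cancel₀ _ (by positivity)]

/-- A function whose derivative of some order is polynomial on an interval is polynomial there. -/
lemma exists_polynomial_of_iteratedDerivWithin_eq {a b : ℝ} (hab : a < b) {f : ℝ → ℝ}
    (hf : ContDiffOn ℝ (⊤ : ℕ∞) f (Icc a b)) (k : ℕ) (Q : Polynomial ℝ)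
    (h : ∀ x ∈ Icc a b, iteratedDerivWithin k f (Icc a b) x = Q.eval x) :
    ∃ P : Polynomial ℝ, ∀ x ∈ Icc a b, f x = P.eval x := by
  have hu := uniqueDiffOn_Icc hab
  induction k generalizing Q with
  | zero => exact ⟨Q, by simpa using h⟩
  | succ k ih =>
    obtain ⟨P, hP⟩ := exists_derivative_eq Q
    have hd := hf.differentiableOn_iteratedDerivWithin (m := k)
      (by exact_mod_cast WithTop.coe_lt_top _) hu
    have hc := constant_of_derivWithin_zero (hd.sub P.differentiableOn) (fun x hx => by
      have hx' := Ico_subset_Icc_self hx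
      rw [derivWithin_sub (hd x hx') P.differentiableAt.differentiableWithinAt,
        ← iteratedDerivWithin_succ, h x hx',
        P.differentiableAt.derivWithin (hu x hx'), Polynomial.deriv, hP, sub_self])
    refine ih (P + Polynomial.C (iteratedDerivWithin k f (Icc a b) a - P.eval a)) fun x hx => ?_
    have := hc x hx
    simp only [Pi.sub_apply] at this
    simp only [Polynomial.eval_add, Polynomial.eval_C]
    linarith

open Polynomial.Bivariate in
lemma not_dvd_pderiv_one {F : MvPolynomial (Fin 2) ℝ}
    (h0 : ((equivMvPolynomial ℝ).symm F).natDegree ≠ 0) : ¬ F ∣ pderiv 1 F := by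
  intro h
  have e := pderiv_one_equivMvPolynomial ((equivMvPolynomial ℝ).symm F)
  rw [AlgEquiv.apply_symm_apply] at e
  rw [e, ← AlgEquiv.apply_symm_apply (equivMvPolynomial ℝ) F, map_dvd_iff,
    AlgEquiv.symm_apply_apply] at h
  have hlt := Polynomial.natDegree_derivative_lt h0
  have := Polynomial.eq_zero_of_dvd_of_natDegree_lt h hlt
  exact h0 (Polynomial.derivative_eq_zero.1 this)

open Polynomial.Bivariate in
lemma natDegree_equivMvPolynomial_symm_ne_zero {a b : ℝ} (hab : a < b)
    {F : MvPolynomial (Fin 2) ℝ} (hF0 : F ≠ 0) {f : ℝ → ℝ}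
    (hF : ∀ x ∈ Icc a b, eval ![x, f x] F = 0) :
    ((equivMvPolynomial ℝ).symm F).natDegree ≠ 0 := by
  intro h
  obtain ⟨g, hg⟩ := Polynomial.natDegree_eq_zero.1 h
  have hg0 : g = 0 := by
    refine Polynomial.eq_zero_of_infinite_isRoot g ((Icc_infinite hab).mono fun x hx => ?_)
    have := hF x hx
    rwa [← evalEval_equivMvPolynomial_symm, ← hg, Polynomial.evalEval_C] at this
  rw [hg0, map_zero] at hg
  exact hF0 (by simpa using hg.symm)

/-- Level sets of derivatives of an algebraic non-polynomial function have `O(k d²)`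
points, with absolute implied constant. -/
theorem stmt_11 :
    ∃ C : ℝ, 0 < C ∧ ∀ (a b : ℝ), a < b → ∀ (d : ℕ), 2 ≤ d →
      ∀ F : MvPolynomial (Fin 2) ℝ, Irreducible F → F.totalDegree = d →
      ∀ f : ℝ → ℝ, ContDiffOn ℝ (⊤ : ℕ∞) f (Icc a b) →
      (∀ x ∈ Icc a b, MvPolynomial.eval ![x, f x] F = 0) →
      (¬ ∃ P : Polynomial ℝ, ∀ x ∈ Icc a b, f x = P.eval x) →
      ∀ k : ℕ, 1 ≤ k → ∀ c : ℝ, c ≠ 0 →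
        {x ∈ Icc a b | iteratedDerivWithin k f (Icc a b) x = c}.Finite ∧
        ({x ∈ Icc a b | iteratedDerivWithin k f (Icc a b) x = c}.ncard : ℝ) ≤
          C * k * d ^ 2 := by
  refine ⟨4, by norm_num, ?_⟩
  rintro a b hab d - F hirr rfl f hf hF hpoly k hk c -
  obtain ⟨j, rfl⟩ := Nat.exists_eq_add_of_le' hk
  have hu := uniqueDiffOn_Icc hab
  have h0 := natDegree_equivMvPolynomial_symm_ne_zero hab hirr.ne_zero hF
  have hH := eval_derivNumerator_add hab hf hF j
  set R := derivNumerator F j + pderiv 1 F ^ (2 * j + 1) * C c with hR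
  have hRdeg : R.totalDegree ≤ (2 * j + 1) * F.totalDegree := by
    refine (totalDegree_add _ _).trans (max_le (totalDegree_derivNumerator_le F j) ?_)
    refine (totalDegree_mul_le_of_le (totalDegree_pow _ _) (n := 0) (by simp)).trans ?_
    exact Nat.mul_le_mul_left _ (totalDegree_pderiv_le 1 F)
  have hFR : ¬ F ∣ R := by
    rintro ⟨S, hS⟩
    have hfin := (ncard_abscissae_common_zeros_le hirr h0 (not_dvd_pderiv_one h0)).1
    set Z := {x : ℝ | ∃ y, eval ![x, y] F = 0 ∧ eval ![x, y] (pderiv 1 F) = 0} with hZ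
    have hcont : ContinuousOn (iteratedDerivWithin (j + 1) f (Icc a b)) (Icc a b) :=
      hf.continuousOn_iteratedDerivWithin (by exact_mod_cast le_top) hu
    have hoff : ∀ x ∈ Icc a b, x ∉ Z → iteratedDerivWithin (j + 1) f (Icc a b) x = c := by
      intro x hx hxZ
      have h1 := hH x hx
      have h2 : eval ![x, f x] R = 0 := by rw [hS, map_mul, hF x hx, zero_mul]
      simp only [hR, map_add, map_mul, map_pow, eval_C] at h2
      have h3 : eval ![x, f x] (pderiv 1 F) ≠ 0 := fun h => hxZ ⟨f x, hF x hx, h⟩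
      exact mul_left_cancel₀ (pow_ne_zero (2 * j + 1) h3) (by linarith)
    have hdense : Icc a b ⊆ closure (Ioo a b ∩ Zᶜ) := by
      have hd : Dense Zᶜ := hfin.countable.dense_compl ℝ
      rw [← closure_Ioo hab.ne]
      exact closure_minimal (hd.open_subset_closure_inter isOpen_Ioo) isClosed_closure
    refine hpoly (exists_polynomial_of_iteratedDerivWithin_eq hab hf (j + 1) (Polynomial.C c) ?_)
    have : EqOn (iteratedDerivWithin (j + 1) f (Icc a b)) (fun _ => c) (Icc a b) :=
      EqOn.of_subset_closure (s := Ioo a b ∩ Zᶜ)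
        (fun x hx => hoff x (Ioo_subset_Icc_self hx.1) hx.2) hcont continuousOn_const
        (inter_subset_left.trans Ioo_subset_Icc_self) hdense
    exact fun x hx => by simpa using this hx
  obtain ⟨hfin, hcard⟩ := ncard_abscissae_common_zeros_le hirr h0 hFR
  have hsub : {x ∈ Icc a b | iteratedDerivWithin (j + 1) f (Icc a b) x = c} ⊆
      {x : ℝ | ∃ y, eval ![x, y] F = 0 ∧ eval ![x, y] R = 0} := by
    rintro x ⟨hx, hxc⟩
    refine ⟨f x, hF x hx, ?_⟩
    have := hH x hx
    rw [hxc] at this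
    simpa [hR] using this
  refine ⟨hfin.subset hsub, ?_⟩
  have hle : {x ∈ Icc a b | iteratedDerivWithin (j + 1) f (Icc a b) x = c}.ncard ≤
      4 * (j + 1) * F.totalDegree ^ 2 := by
    refine ((Set.ncard_le_ncard hsub hfin).trans hcard).trans ?_
    refine (Nat.mul_le_mul_left _ hRdeg).trans ?_
    nlinarith [sq_nonneg F.totalDegree]
  exact_mod_cast hle
end

section
/- Let M be a finite set of monomials in ℝ[x,y] with D = |M| ≥ 2, and let p = Σ_{x^{j₁}y^{j₂} ∈ M} j₁, q = Σ_{x^{j₁}y^{j₂} ∈ M} j₂. Let I ⊆ [0,N] be a closed interval and f ∈ C^{D−1}(I) with |f^{(i)}(x)/i!| ≤ X·δ^i for all 0 ≤ i < D and x ∈ I, where X > 0 and δ ≥ 1/N. If |I| < (1/4)·δ^{−1}·((2N)^p·(D·X)^q)^{−1/binom(D,2)}, then all points of {(x, f(x)) : x ∈ I} ∩ ℤ² lie on the zero set of a single nonzero polynomial in ℝ[x,y] whose monomials all belong to M. -/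
open Set Finset Real

/-- Iterated Rolle theorem. -/
theorem exists_iteratedDerivWithin_eq_zero {a b : ℝ} (hab : a < b) (n : ℕ) {h : ℝ → ℝ}
    (hh : ContDiffOn ℝ n h (Set.Icc a b)) {x : ℕ → ℝ} (hx : ∀ m ≤ n, x m ∈ Set.Icc a b)
    (hlt : ∀ m < n, x m < x (m + 1)) (hzero : ∀ m ≤ n, h (x m) = 0) :
    ∃ ξ ∈ Set.Icc a b, iteratedDerivWithin n h (Set.Icc a b) ξ = 0 := by
  induction n generalizing h x with
  | zero => exact ⟨x 0, hx 0 le_rfl, by simpa using hzero 0 le_rfl⟩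
  | succ n ih =>
    have hud := uniqueDiffOn_Icc hab
    have hrolle : ∀ m, ∃ y, m ≤ n →
        x m < y ∧ y < x (m + 1) ∧ derivWithin h (Set.Icc a b) y = 0 := by
      intro m
      by_cases hm : m ≤ n
      · have hsub : Set.Icc (x m) (x (m + 1)) ⊆ Set.Icc a b :=
          Set.Icc_subset_Icc (hx m (by omega)).1 (hx (m + 1) (by omega)).2
        obtain ⟨y, hy, hy0⟩ := exists_deriv_eq_zero (hlt m (by omega))
          (hh.continuousOn.mono hsub)
          ((hzero m (by omega)).trans (hzero (m + 1) (by omega)).symm)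
        refine ⟨y, fun _ => ⟨hy.1, hy.2, ?_⟩⟩
        rw [derivWithin_of_mem_nhds, hy0]
        exact Filter.mem_of_superset (Icc_mem_nhds hy.1 hy.2) hsub
      · exact ⟨0, fun h => absurd h hm⟩
    choose y hy using hrolle
    rw [iteratedDerivWithin_succ']
    refine ih (x := y) ?_ (fun m hm => ?_) (fun m hm => ?_) (fun m hm => (hy m hm).2.2)
    · push_cast at hh
      exact ((contDiffOn_succ_iff_derivWithin hud).1 hh).2.2
    · exact ⟨(hx m (by omega)).1.trans (hy m hm).1.le,
        (hy m hm).2.1.le.trans (hx (m + 1) (by omega)).2⟩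
    · exact (hy m hm.le).2.1.trans (hy (m + 1) hm).1

theorem Polynomial.iteratedDerivWithin_eval {s : Set ℝ} (hs : UniqueDiffOn ℝ s) (n : ℕ)
    (P : Polynomial ℝ) {x : ℝ} (hx : x ∈ s) :
    iteratedDerivWithin n (fun y => P.eval y) s x = (Polynomial.derivative^[n] P).eval x := by
  induction n generalizing P with
  | zero => simp
  | succ n ih =>
    rw [iteratedDerivWithin_succ', Function.iterate_succ_apply, ← ih]
    refine iteratedDerivWithin_congr (fun y hy => ?_) hx
    exact P.derivWithin (hs y hy)

theorem Polynomial.iterate_derivative_eval_of_natDegree_le {n : ℕ} {P : Polynomial ℝ}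
    (hP : P.natDegree ≤ n) (x : ℝ) :
    (Polynomial.derivative^[n] P).eval x = n.factorial * P.coeff n := by
  have h0 : (Polynomial.derivative^[n] P).natDegree = 0 := by
    have := Polynomial.natDegree_iterate_derivative P n
    omega
  rw [Polynomial.eq_C_of_natDegree_eq_zero h0, Polynomial.eval_C,
    Polynomial.coeff_iterate_derivative]
  simp [Nat.descFactorial_self]

/-- Newton interpolation: the coefficients are Taylor coefficients at intermediate points. -/
theorem exists_newton_interpolation {a b : ℝ} (hab : a < b) (n : ℕ) {g : ℝ → ℝ}
    (hg : ∀ i < n, ContDiffOn ℝ i g (Set.Icc a b)) {x : ℕ → ℝ}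
    (hx : ∀ m < n, x m ∈ Set.Icc a b) (hlt : ∀ m, m + 1 < n → x m < x (m + 1)) :
    ∃ c : ℕ → ℝ,
      (∀ m < n, g (x m) =
        ∑ i ∈ Finset.range n, c i * ∏ k ∈ Finset.range i, (x m - x k)) ∧
      ∀ i < n, ∃ ξ ∈ Set.Icc a b,
        c i = iteratedDerivWithin i g (Set.Icc a b) ξ / i.factorial := by
  induction n with
  | zero => exact ⟨0, by simp, by simp⟩
  | succ n ih =>
    obtain ⟨c, hc, hcξ⟩ := ih (fun i hi => hg i (by omega)) (fun m hm => hx m (by omega))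
      (fun m hm => hlt m (by omega))
    have hlt' : ∀ m k, k < m → m < n + 1 → x k < x m := by
      intro m k hk
      induction m, hk using Nat.le_induction with
      | base => exact fun h => hlt k h
      | succ m hm ih => exact fun h => (ih (by omega)).trans (hlt m h)
    have hprod : ∏ k ∈ Finset.range n, (x n - x k) ≠ 0 :=
      Finset.prod_ne_zero_iff.2 fun k hk =>
        sub_ne_zero.2 (hlt' n k (Finset.mem_range.1 hk) (by omega)).ne'
    set t := (g (x n) - ∑ i ∈ Finset.range n, c i * ∏ k ∈ Finset.range i, (x n - x k)) /
      ∏ k ∈ Finset.range n, (x n - x k) with ht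
    set P : Polynomial ℝ := (∑ i ∈ Finset.range n,
      Polynomial.C (c i) * Lagrange.nodal (Finset.range i) x) +
        Polynomial.C t * Lagrange.nodal (Finset.range n) x with hP
    have hPeval : ∀ y, P.eval y =
        (∑ i ∈ Finset.range n, c i * ∏ k ∈ Finset.range i, (y - x k)) +
          t * ∏ k ∈ Finset.range n, (y - x k) := by
      intro y
      simp [hP, Polynomial.eval_finsetSum, Lagrange.eval_nodal]
    have hPdeg : P.natDegree ≤ n := by
      refine Polynomial.natDegree_add_le_of_degree_le
        (Polynomial.natDegree_sum_le_of_forall_le _ _ fun i hi => ?_) ?_ <;>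
      refine (Polynomial.natDegree_C_mul_le _ _).trans ?_ <;>
      rw [Lagrange.natDegree_nodal, Finset.card_range]
      exact (Finset.mem_range.1 hi).le
    have hPcoeff : P.coeff n = t := by
      have htop : (Lagrange.nodal (Finset.range n) x).coeff n = 1 := by
        have := (Lagrange.nodal_monic (s := Finset.range n) (v := x)).coeff_natDegree
        rwa [Lagrange.natDegree_nodal, Finset.card_range] at this
      rw [hP, Polynomial.coeff_add, Polynomial.finsetSum_coeff, Polynomial.coeff_C_mul, htop,
        mul_one, Finset.sum_eq_zero, zero_add]
      intro i hi
      rw [Polynomial.coeff_C_mul, Polynomial.coeff_eq_zero_of_natDegree_lt, mul_zero]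
      rw [Lagrange.natDegree_nodal, Finset.card_range]
      exact Finset.mem_range.1 hi
    have hPg : ∀ m ≤ n, g (x m) = P.eval (x m) := by
      intro m hm
      rw [hPeval]
      rcases hm.lt_or_eq with hm | rfl
      · rw [← hc m hm, Finset.prod_eq_zero (Finset.mem_range.2 hm) (sub_self _)]
        simp
      · rw [ht, div_mul_cancel₀ _ hprod]
        ring
    have hPsmooth : ContDiff ℝ n (fun y => P.eval y) := by
      simpa using P.contDiff_aeval (𝕜 := ℝ) n
    obtain ⟨ξ, hξ, hξ0⟩ := exists_iteratedDerivWithin_eq_zero hab n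
      (h := g - fun y => P.eval y) ((hg n (by omega)).sub hPsmooth.contDiffOn)
      (fun m hm => hx m (by omega)) (fun m hm => hlt m (by omega))
      (fun m hm => by simp [hPg m hm])
    rw [iteratedDerivWithin_sub hξ (uniqueDiffOn_Icc hab) (hg n (by omega) ξ hξ)
      hPsmooth.contDiffWithinAt, Polynomial.iteratedDerivWithin_eval (uniqueDiffOn_Icc hab) n P hξ,
      Polynomial.iterate_derivative_eval_of_natDegree_le hPdeg, hPcoeff, sub_eq_zero] at hξ0
    refine ⟨Function.update c n t, fun m hm => ?_, fun i hi => ?_⟩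
    · rw [Finset.sum_range_succ, Function.update_self, hPg m (by omega), hPeval]
      congr 1
      refine Finset.sum_congr rfl fun i hi => ?_
      rw [Function.update_of_ne (Finset.mem_range.1 hi).ne]
    · rcases (Nat.lt_succ_iff.1 hi).lt_or_eq with hi | rfl
      · rw [Function.update_of_ne hi.ne]
        exact hcξ i hi
      · refine ⟨ξ, hξ, ?_⟩
        rw [Function.update_self, hξ0]
        field_simp

/-- Leibniz rule for bounds on Taylor coefficients. -/
theorem abs_iteratedDerivWithin_mul_div_factorial_le {s : Set ℝ} (hs : UniqueDiffOn ℝ s) {D : ℕ}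
    {u g : ℝ → ℝ} (hu : ∀ i < D, ContDiffOn ℝ i u s) (hg : ∀ i < D, ContDiffOn ℝ i g s)
    {U : ℕ → ℝ} {δ K A : ℝ} (hδ : 0 ≤ δ) (hA : 0 ≤ A) (hU0 : ∀ i, 0 ≤ U i)
    (hUK : ∑ i ∈ Finset.range D, U i ≤ K)
    (hub : ∀ i < D, ∀ x ∈ s, |iteratedDerivWithin i u s x / (i.factorial : ℝ)| ≤ U i * δ ^ i)
    (hgb : ∀ i < D, ∀ x ∈ s, |iteratedDerivWithin i g s x / (i.factorial : ℝ)| ≤ A * δ ^ i) :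
    ∀ i < D, ∀ x ∈ s,
      |iteratedDerivWithin i (u * g) s x / (i.factorial : ℝ)| ≤ K * A * δ ^ i := by
  intro i hi x hx
  rw [iteratedDerivWithin_mul hx hs (hu i hi x hx) (hg i hi x hx), Finset.sum_div]
  calc |∑ k ∈ Finset.range (i + 1), (i.choose k * iteratedDerivWithin k u s x *
          iteratedDerivWithin (i - k) g s x) / (i.factorial : ℝ)|
      ≤ ∑ k ∈ Finset.range (i + 1), U k * (A * δ ^ i) := by
        refine (Finset.abs_sum_le_sum_abs _ _).trans (Finset.sum_le_sum fun k hk => ?_)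
        have hk : k ≤ i := Nat.lt_succ_iff.1 (Finset.mem_range.1 hk)
        have hfac : (i.choose k * iteratedDerivWithin k u s x *
            iteratedDerivWithin (i - k) g s x) / (i.factorial : ℝ) =
            (iteratedDerivWithin k u s x / (k.factorial : ℝ)) *
              (iteratedDerivWithin (i - k) g s x / ((i - k).factorial : ℝ)) := by
          rw [Nat.cast_choose ℝ hk]
          field_simp
        have hpow : U k * (A * δ ^ i) = U k * δ ^ k * (A * δ ^ (i - k)) := by
          rw [← Nat.add_sub_of_le hk, Nat.add_sub_cancel_left, pow_add]
          ring
        rw [hfac, abs_mul, hpow]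
        exact mul_le_mul (hub k (by omega) x hx) (hgb (i - k) (by omega) x hx) (abs_nonneg _)
          (mul_nonneg (hU0 k) (pow_nonneg hδ k))
    _ ≤ K * A * δ ^ i := by
        rw [← Finset.sum_mul, mul_assoc]
        refine mul_le_mul_of_nonneg_right (le_trans ?_ hUK) (by positivity)
        exact Finset.sum_le_sum_of_subset_of_nonneg
          (Finset.range_subset_range.2 (by omega)) fun k _ _ => hU0 k

/-- Bounds on the Taylor coefficients of `x ^ m * f x ^ n`. -/
theorem abs_iteratedDerivWithin_monomial_div_factorial_le {s : Set ℝ} (hs : UniqueDiffOn ℝ s)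
    {D : ℕ} (hD : 2 ≤ D) {f : ℝ → ℝ} (hf : ∀ i < D, ContDiffOn ℝ i f s) {N X δ : ℝ}
    (hN : 0 < N) (hX : 0 < X) (hδ : 1 / N ≤ δ) (hsN : ∀ x ∈ s, |x| ≤ N)
    (hb : ∀ i < D, ∀ x ∈ s, |iteratedDerivWithin i f s x / (i.factorial : ℝ)| ≤ X * δ ^ i)
    (m n : ℕ) :
    ∀ i < D, ∀ x ∈ s, |iteratedDerivWithin i (fun y => y ^ m * f y ^ n) s x / (i.factorial : ℝ)| ≤
      (2 * N) ^ m * (D * X) ^ n * δ ^ i := by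
  have hδ0 : 0 < δ := lt_of_lt_of_le (by positivity) hδ
  induction m with
  | zero =>
    simp only [pow_zero, one_mul]
    induction n with
    | zero =>
      intro i hi x hx
      simp only [pow_zero, one_mul, iteratedDerivWithin_const]
      split_ifs with h
      · simp [h]
      · simp only [zero_div, abs_zero]
        positivity
    | succ n ih =>
      have hmul : (fun y => f y ^ (n + 1)) = f * fun y => f y ^ n := by
        ext y
        exact pow_succ' _ _
      rw [hmul, pow_succ']
      exact abs_iteratedDerivWithin_mul_div_factorial_le hs hf (fun i hi => (hf i hi).pow n)
        (U := fun _ => X) hδ0.le (by positivity) (fun _ => hX.le) (by simp) hb ih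
  | succ m ih =>
    have hmul : (fun y => y ^ (m + 1) * f y ^ n) = id * fun y => y ^ m * f y ^ n := by
      ext y
      simp only [Pi.mul_apply, id_eq]
      ring
    rw [hmul, pow_succ', mul_assoc (2 * N)]
    refine abs_iteratedDerivWithin_mul_div_factorial_le hs (fun i _ => contDiffOn_id)
      (fun i hi => (contDiffOn_id.pow m).mul ((hf i hi).pow n))
      (U := fun i => if i < 2 then N else 0) hδ0.le (by positivity)
      (fun i => by split_ifs <;> positivity) ?_ (fun i hi x hx => ?_) ih
    · obtain ⟨k, rfl⟩ := Nat.exists_eq_add_of_le hD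
      rw [Finset.sum_range_add]
      have h0 : ∑ i ∈ Finset.range k, (if 2 + i < 2 then N else 0) = 0 :=
        Finset.sum_eq_zero fun i _ => if_neg (by omega)
      rw [h0]
      simp [Finset.sum_range_succ, two_mul]
    · rw [iteratedDerivWithin_id hx hs]
      match i with
      | 0 => simpa using hsN x hx
      | 1 => simpa using (div_le_iff₀' hN).1 hδ
      | i + 2 => simp

/-- A determinant of function values is small when the nodes are close together. -/
theorem abs_det_le_of_taylor_bounds {a b : ℝ} (hab : a < b) {D : ℕ} {g : Fin D → ℝ → ℝ}
    (hg : ∀ j, ∀ i < D, ContDiffOn ℝ i (g j) (Set.Icc a b)) {A : Fin D → ℝ} {δ : ℝ}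
    (hgb : ∀ j, ∀ i < D, ∀ x ∈ Set.Icc a b,
      |iteratedDerivWithin i (g j) (Set.Icc a b) x / (i.factorial : ℝ)| ≤ A j * δ ^ i)
    {x : Fin D → ℝ} (hx : ∀ m, x m ∈ Set.Icc a b) (hmono : StrictMono x) :
    |(Matrix.of fun m j => g j (x m)).det| ≤
      D.factorial * (∏ j, A j) * ((b - a) * δ) ^ D.choose 2 := by
  set y : ℕ → ℝ := fun m => if h : m < D then x ⟨m, h⟩ else 0 with hy
  have hyx : ∀ m : Fin D, y m = x m := fun m => by simp [hy]
  have hym : ∀ m < D, y m ∈ Set.Icc a b := fun m hm => by simpa [hy, hm] using hx ⟨m, hm⟩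
  have hylt : ∀ m, m + 1 < D → y m < y (m + 1) := fun m hm => by
    rw [hyx ⟨m, by omega⟩, hyx ⟨m + 1, hm⟩]
    exact hmono (Nat.lt_succ_self m)
  choose c hc hcb using fun j => exists_newton_interpolation hab D (hg j) hym hylt
  set V : Matrix (Fin D) (Fin D) ℝ :=
    Matrix.of fun m i => ∏ k ∈ Finset.range i, (y m - y k) with hV
  set C : Matrix (Fin D) (Fin D) ℝ := Matrix.of fun i j => c j i with hC
  have hfac : (Matrix.of fun m j => g j (x m)) = V * C := by
    ext m j
    rw [Matrix.mul_apply, Matrix.of_apply, ← hyx, hc j m m.2, Finset.sum_range]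
    exact Finset.sum_congr rfl fun i _ => mul_comm _ _
  have hVdet : |V.det| ≤ (b - a) ^ D.choose 2 := by
    rw [Matrix.det_of_isLowerTriangular, Finset.abs_prod]
    · calc ∏ i : Fin D, |V i i| ≤ ∏ i : Fin D, (b - a) ^ (i : ℕ) := by
            refine Finset.prod_le_prod (fun _ _ => abs_nonneg _) fun i _ => ?_
            rw [hV, Matrix.of_apply, Finset.abs_prod]
            refine (Finset.prod_le_prod (g := fun _ => b - a) (fun _ _ => abs_nonneg _)
              fun k hk => ?_).trans (by simp)
            have hk := Finset.mem_range.1 hk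
            have h1 := hym i i.2
            have h2 := hym k (by omega)
            exact abs_le.2 ⟨by linarith [h1.1, h2.2], by linarith [h1.2, h2.1]⟩
        _ = (b - a) ^ D.choose 2 := by
            rw [Finset.prod_pow_eq_pow_sum, Fin.sum_univ_eq_sum_range (fun i => i),
              Finset.sum_range_id, Nat.choose_two_right]
    · intro m i hmi
      exact Finset.prod_eq_zero (Finset.mem_range.2 hmi) (sub_self _)
  have hCdet : |C.det| ≤ D.factorial * (∏ j, A j) * δ ^ D.choose 2 := by
    rw [Matrix.det_apply']
    refine (Finset.abs_sum_le_sum_abs _ _).trans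
      ((Finset.sum_le_card_nsmul _ _ ((∏ j, A j) * δ ^ D.choose 2) fun σ _ => ?_).trans ?_)
    · rw [abs_mul, Finset.abs_prod]
      have hsign : |((Equiv.Perm.sign σ : ℤ) : ℝ)| = 1 := by
        rcases Int.units_eq_one_or (Equiv.Perm.sign σ) with h | h <;> simp [h]
      rw [hsign, one_mul]
      calc ∏ j, |C (σ j) j| ≤ ∏ j, A j * δ ^ (σ j : ℕ) := by
            refine Finset.prod_le_prod (fun _ _ => abs_nonneg _) fun j _ => ?_
            obtain ⟨ξ, hξ, h⟩ := hcb j (σ j) (σ j).2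
            rw [hC, Matrix.of_apply, h]
            exact hgb j _ (σ j).2 ξ hξ
        _ = (∏ j, A j) * δ ^ D.choose 2 := by
            rw [Finset.prod_mul_distrib, Finset.prod_pow_eq_pow_sum,
              Equiv.sum_comp σ (fun j : Fin D => (j : ℕ)),
              Fin.sum_univ_eq_sum_range (fun i => i), Finset.sum_range_id, Nat.choose_two_right]
    · simp [Finset.card_univ, Fintype.card_perm, mul_assoc]
  rw [hfac, Matrix.det_mul, abs_mul, mul_pow]
  calc |V.det| * |C.det| ≤ (b - a) ^ D.choose 2 * (D.factorial * (∏ j, A j) * δ ^ D.choose 2) := by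
        gcongr
    _ = _ := by ring

theorem Nat.factorial_le_four_pow_choose_two (D : ℕ) : D.factorial ≤ 4 ^ D.choose 2 := by
  induction D with
  | zero => simp
  | succ n ih =>
    rw [Nat.factorial_succ, Nat.choose_succ_succ' n 1, Nat.choose_one_right, pow_add]
    refine Nat.mul_le_mul ?_ ih
    exact Nat.lt_pow_self (by norm_num)

/-- Vectors lying in no common hyperplane contain a basis. -/
theorem exists_linearIndependent_of_forall_dual {ι K : Type*} [Field K] {D : ℕ}
    (S : Set ι) (v : ι → Fin D → K)
    (h : ∀ c : Fin D → K, c ≠ 0 → ∃ s ∈ S, ∑ j, c j * v s j ≠ 0) :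
    ∃ x : Fin D → ι, (∀ m, x m ∈ S) ∧ LinearIndependent K fun m => v (x m) := by
  have htop : Submodule.span K (Set.image v S) = ⊤ := by
    by_contra hne
    obtain ⟨φ, hφ, hker⟩ := Submodule.exists_le_ker_of_lt_top _ (lt_top_iff_ne_top.2 hne)
    have hsum : ∀ w, φ w = ∑ j, φ (Pi.single j 1) * w j := fun w => by
      rw [φ.pi_apply_eq_sum_univ w]
      refine Finset.sum_congr rfl fun j _ => ?_
      rw [smul_eq_mul, mul_comm]
      congr 2
      ext k
      simp [Pi.single_apply, eq_comm]
    obtain ⟨s, hs, hsne⟩ := h (fun j => φ (Pi.single j 1)) fun h0 => hφ <|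
        LinearMap.ext fun w => by
      rw [hsum w]
      simp [fun j => congrFun h0 j]
    exact hsne ((hsum _).symm.trans (hker (Submodule.subset_span ⟨s, hs, rfl⟩)))
  obtain ⟨w, hw, -, hli⟩ := Submodule.exists_fun_fin_finrank_span_eq K (Set.image v S)
  have hrank : D = Module.finrank K (Submodule.span K (Set.image v S)) := by
    rw [htop, finrank_top, Module.finrank_fin_fun]
  choose x hx hxw using hw
  refine ⟨x ∘ Fin.cast hrank, fun m => hx _, ?_⟩
  simpa [Function.comp_def, hxw] using hli.comp _ (Fin.cast_injective hrank)

/-- Bombieri–Pila single-curve covering lemma: a short enough graph segment with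
rapidly decaying derivatives has all its integer points on one curve supported
on the monomial set `M`. -/
theorem stmt_18 (M : Finset (ℕ × ℕ)) (D : ℕ) (hD : D = M.card) (hD2 : 2 ≤ D)
    (p q : ℕ) (hp : p = ∑ j ∈ M, j.1) (hq : q = ∑ j ∈ M, j.2)
    (N : ℝ) (hN : 0 < N) (a b : ℝ) (hab : a < b) (ha : 0 ≤ a) (hb : b ≤ N)
    (f : ℝ → ℝ) (hf : ContDiffOn ℝ (D - 1 : ℕ) f (Icc a b))
    (X δ : ℝ) (hX : 0 < X) (hδ : 1 / N ≤ δ)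
    (hbound : ∀ i < D, ∀ x ∈ Icc a b,
      |iteratedDerivWithin i f (Icc a b) x / (Nat.factorial i : ℝ)| ≤ X * δ ^ i)
    (hlen : b - a <
      (1 / 4) * δ⁻¹ *
        ((2 * N) ^ p * ((D : ℝ) * X) ^ q) ^ (-(1 / (Nat.choose D 2 : ℝ)))) :
    ∃ c : ℕ × ℕ → ℝ, (∃ j ∈ M, c j ≠ 0) ∧
      ∀ x ∈ Icc a b, (∃ m : ℤ, x = (m : ℝ)) → (∃ k : ℤ, f x = (k : ℝ)) →
        ∑ j ∈ M, c j * x ^ j.1 * f x ^ j.2 = 0 := by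
  by_contra! hno
  have hδ0 : 0 < δ := lt_of_lt_of_le (by positivity) hδ
  have hfi : ∀ i < D, ContDiffOn ℝ i f (Set.Icc a b) := fun i hi =>
    hf.of_le (by exact_mod_cast Nat.le_sub_one_of_lt hi)
  let e : M ≃ Fin D := M.equivFinOfCardEq hD.symm
  let g : Fin D → ℝ → ℝ := fun j y => y ^ (e.symm j).1.1 * f y ^ (e.symm j).1.2
  obtain ⟨x, hxS, hli⟩ := exists_linearIndependent_of_forall_dual
    {x | x ∈ Set.Icc a b ∧ (∃ m : ℤ, x = m) ∧ ∃ k : ℤ, f x = k} (fun y j => g j y)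
    (fun c hc => by
      obtain ⟨j, hj⟩ := Function.ne_iff.1 hc
      obtain ⟨y, hy, hym, hyk, hsum⟩ := hno (fun i => if h : i ∈ M then c (e ⟨i, h⟩) else 0)
        ⟨(e.symm j).1, (e.symm j).2, by simpa using hj⟩
      refine ⟨y, ⟨hy, hym, hyk⟩, ?_⟩
      convert hsum using 1
      rw [← Finset.sum_coe_sort M, ← Equiv.sum_comp e]
      refine Finset.sum_congr rfl fun i _ => ?_
      simp [g, mul_assoc])
  have hxinj : Function.Injective x := fun m m' h => hli.injective (by simp only [h])
  set σ := Tuple.sort x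
  have hmono : StrictMono (x ∘ σ) :=
    (Tuple.monotone_sort x).strictMono_of_injective (hxinj.comp σ.injective)
  set A : Matrix (Fin D) (Fin D) ℝ := Matrix.of fun m j => g j ((x ∘ σ) m) with hA
  have hdet : A.det ≠ 0 := by
    have h : LinearIndependent ℝ A.row := hli.comp σ σ.injective
    exact ((Matrix.isUnit_iff_isUnit_det A).1
      (Matrix.linearIndependent_rows_iff_isUnit.1 h)).ne_zero
  have hle : 1 ≤ |A.det| := by
    choose m hm using fun i => (hxS (σ i)).2.1
    choose k hk using fun i => (hxS (σ i)).2.2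
    have hAint : A = (Matrix.of fun i j =>
        m i ^ (e.symm j).1.1 * k i ^ (e.symm j).1.2 : Matrix (Fin D) (Fin D) ℤ).map
          (Int.castRingHom ℝ) := by
      ext i j
      simp [hA, g, hk i, ← hm i]
    rw [hAint, ← RingHom.mapMatrix_apply, ← RingHom.map_det] at hdet ⊢
    simp only [eq_intCast, ne_eq, Int.cast_eq_zero] at hdet ⊢
    exact_mod_cast Int.one_le_abs hdet
  have hupper := abs_det_le_of_taylor_bounds hab (g := g)
    (A := fun j => (2 * N) ^ (e.symm j).1.1 * (D * X) ^ (e.symm j).1.2)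
    (fun j i hi => (contDiffOn_id.pow _).mul ((hfi i hi).pow _))
    (fun j => abs_iteratedDerivWithin_monomial_div_factorial_le (uniqueDiffOn_Icc hab) hD2 hfi hN hX
      hδ (fun y hy => abs_le.2 ⟨by linarith [hy.1], hy.2.trans hb⟩) hbound _ _)
    (fun i => (hxS (σ i)).1) hmono
  set Q := (2 * N) ^ p * ((D : ℝ) * X) ^ q with hQ
  have hDpos : (0 : ℝ) < D := by exact_mod_cast (by omega : 0 < D)
  have hQ0 : 0 < Q := by positivity
  have hprod : ∏ j, (2 * N) ^ (e.symm j).1.1 * ((D : ℝ) * X) ^ (e.symm j).1.2 = Q := by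
    rw [Equiv.prod_comp e.symm fun i : M => (2 * N) ^ i.1.1 * ((D : ℝ) * X) ^ i.1.2,
      Finset.prod_coe_sort M fun i : ℕ × ℕ => (2 * N) ^ i.1 * ((D : ℝ) * X) ^ i.2,
      Finset.prod_mul_distrib, Finset.prod_pow_eq_pow_sum, Finset.prod_pow_eq_pow_sum, hQ, hp, hq]
  rw [hprod] at hupper
  have hC : D.choose 2 ≠ 0 := (Nat.choose_pos hD2).ne'
  have hshort : ((b - a) * δ) ^ D.choose 2 < (1 / 4) ^ D.choose 2 * Q⁻¹ := by
    have h1 : (b - a) * δ < 1 / 4 * Q ^ (-(1 / (D.choose 2 : ℝ))) := by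
      calc (b - a) * δ < (1 / 4) * δ⁻¹ * Q ^ (-(1 / (D.choose 2 : ℝ))) * δ := by gcongr
        _ = _ := by field_simp
    have h2 := pow_lt_pow_left₀ h1 (mul_nonneg (sub_nonneg.2 hab.le) hδ0.le) hC
    rwa [mul_pow (1 / 4), Real.rpow_neg hQ0.le, inv_pow, one_div (D.choose 2 : ℝ),
      Real.rpow_inv_natCast_pow hQ0.le hC] at h2
  have hfact : (D.factorial : ℝ) ≤ 4 ^ D.choose 2 := by
    exact_mod_cast Nat.factorial_le_four_pow_choose_two D
  refine absurd (hle.trans hupper) (not_le.2 ?_)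
  calc D.factorial * Q * ((b - a) * δ) ^ D.choose 2
      < D.factorial * Q * ((1 / 4) ^ D.choose 2 * Q⁻¹) := by gcongr
    _ = D.factorial / 4 ^ D.choose 2 := by
        rw [one_div, inv_pow]
        field_simp
    _ ≤ 1 := div_le_one_of_le₀ hfact (by positivity)
end
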